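/- arXiv:2011.07767 — 2 statements merged into one kernel-verified Lean document; each statement's English description precedes it below -/
import Mathlib

section
/- For every integer m ≥ 0 and every positive integer n, one has ∑_{π ∈ D(n)} (-1)^{#(π)-1} ∑_{j=1}^{s(π)} (ℓ(π) - s(π) + j)^m = ∑_{d | n} d^m, where the sum on the right runs over the positive divisors d of n. (This is the identity of Bressoud and Subbarao, obtained from the one-parameter generalization by setting a = 1.) -/
open Finset

open scoped Classical

/-- The largest part `ℓ(π)` of a partition. -/
def largestPart {n : ℕ} (p : n.Partition) : ℕ := p.parts.toFinset.sup id

/-- The smallest part `s(π)` of a partition. -/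
noncomputable def smallestPart {n : ℕ} (p : n.Partition) : ℕ := sInf {j | j ∈ p.parts}

/-- The number of parts `#(π)` of a partition. -/
def numParts {n : ℕ} (p : n.Partition) : ℕ := Multiset.card p.parts

/-- `ν(j)`: the multiplicity of `j` as a part of the partition. -/
def mult {n : ℕ} (p : n.Partition) (j : ℕ) : ℕ := p.parts.count j

/-- `ν_d(π)`: the number of distinct parts of the partition. -/
def numDistinctParts {n : ℕ} (p : n.Partition) : ℕ := p.parts.toFinset.card

/-- `D(n)`: the partitions of `n` into distinct parts. -/
def D (n : ℕ) : Finset (n.Partition) := Finset.univ.filter fun p => p.parts.Nodup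

open Polynomial in
/-- The generating function of nonempty sets of positive integers that lie in a window of length
`k` and have maximum `t + k` for some `t < N`, weighted by the parity of the number of nonmaximal
elements. -/
noncomputable def windowPoly (k N : ℕ) : ℤ[X] :=
  ∑ t ∈ Finset.range N, X ^ (t + k) * ∏ i ∈ Finset.Ico (t + 1) (t + k), (1 - X ^ i)

open Polynomial in
theorem one_sub_mul_windowPoly {k : ℕ} (hk : 0 < k) (N : ℕ) :
    (1 - X ^ k) * windowPoly k N = X ^ k * ∏ i ∈ Finset.Ico N (N + k), (1 - X ^ i : ℤ[X]) := by
  induction N with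
  | zero =>
    rw [Finset.prod_eq_zero (i := 0) (by simp [hk]) (by simp)]
    simp [windowPoly]
  | succ N ih =>
    have h1 : windowPoly k (N + 1) = windowPoly k N +
        X ^ (N + k) * ∏ i ∈ Finset.Ico (N + 1) (N + k), (1 - X ^ i) :=
      Finset.sum_range_succ _ _
    have h2 : N + 1 + k = N + k + 1 := by omega
    rw [h1, mul_add, ih, h2, Finset.prod_Ico_succ_top (by omega),
      Finset.prod_eq_prod_Ico_succ_bot (by omega)]
    ring

open Polynomial in
theorem X_pow_dvd_prod_one_sub_X_pow_sub_one (N : ℕ) (s : Finset ℕ) (hs : ∀ i ∈ s, N ≤ i) :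
    (X ^ N : ℤ[X]) ∣ ∏ i ∈ s, (1 - X ^ i) - 1 := by
  refine Finset.prod_induction _ (fun p : ℤ[X] => X ^ N ∣ p - 1) (fun a b ha hb => ?_) (by simp)
    fun i hi => ?_
  · have : a * b - 1 = a * (b - 1) + (a - 1) := by ring
    rw [this]
    exact dvd_add (hb.mul_left a) ha
  · have : (1 - X ^ i - 1 : ℤ[X]) = -X ^ i := by ring
    rw [this, dvd_neg]
    exact pow_dvd_pow X (hs i hi)

open Polynomial in
theorem coeff_one_sub_mul_windowPoly {k N n : ℕ} (hk : 0 < k) (hn : n < N + k) :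
    ((1 - X ^ k) * windowPoly k N).coeff n = if n = k then 1 else 0 := by
  obtain ⟨q, hq⟩ := X_pow_dvd_prod_one_sub_X_pow_sub_one N (Finset.Ico N (N + k))
    fun i hi => (Finset.mem_Ico.1 hi).1
  have h : (X ^ k * ∏ i ∈ Finset.Ico N (N + k), (1 - X ^ i) : ℤ[X]) =
      X ^ k + X ^ (N + k) * q := by
    rw [eq_add_of_sub_eq hq]
    ring
  rw [one_sub_mul_windowPoly hk, h, coeff_add, coeff_X_pow, coeff_X_pow_mul',
    if_neg (not_le.2 hn), add_zero]

open Polynomial in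
theorem coeff_windowPoly {k N : ℕ} (hk : 0 < k) (n : ℕ) (hn : n < N + k) :
    (windowPoly k N).coeff n = if n ≠ 0 ∧ k ∣ n then 1 else 0 := by
  induction n using Nat.strong_induction_on with
  | _ n ih =>
    have h := coeff_one_sub_mul_windowPoly hk hn
    rw [sub_mul, one_mul, coeff_sub, coeff_X_pow_mul', sub_eq_iff_eq_add] at h
    rw [h]
    rcases lt_trichotomy n k with hlt | rfl | hgt
    · have : ¬ (n ≠ 0 ∧ k ∣ n) := fun ⟨h0, hd⟩ =>
        absurd (Nat.le_of_dvd (Nat.pos_of_ne_zero h0) hd) (by omega)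
      simp [this, hlt.ne, hlt.not_ge]
    · rw [if_pos rfl, if_pos le_rfl, ih _ (by omega) (by omega)]
      simp [hk.ne']
    · rw [if_neg hgt.ne', if_pos hgt.le, ih _ (by omega) (by omega), zero_add]
      have h1 : n - k ≠ 0 := by omega
      have h2 : n ≠ 0 := by omega
      have h3 : k ∣ n - k ↔ k ∣ n := by
        conv_rhs => rw [← Nat.sub_add_cancel hgt.le, Nat.dvd_add_self_right]
      simp only [h1, h2, h3, ne_eq, not_false_eq_true, true_and]

open Polynomial in
theorem prod_one_sub_X_pow (s : Finset ℕ) :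
    ∏ i ∈ s, (1 - X ^ i : ℤ[X]) =
      ∑ A ∈ s.powerset, (-1) ^ A.card * X ^ (∑ i ∈ A, i) := by
  simp only [sub_eq_add_neg, Finset.prod_one_add]
  refine Finset.sum_congr rfl fun A _ => ?_
  rw [Finset.prod_neg, Finset.prod_pow_eq_pow_sum]

open Polynomial in
theorem coeff_windowPoly_eq_sum (k N n : ℕ) :
    (windowPoly k N).coeff n =
      ∑ x ∈ ((Finset.range N).sigma fun t => (Finset.Ico (t + 1) (t + k)).powerset) with
        x.1 + k + ∑ i ∈ x.2, i = n, (-1 : ℤ) ^ x.2.card := by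
  rw [Finset.sum_filter, Finset.sum_sigma, windowPoly, finsetSum_coeff]
  refine Finset.sum_congr rfl fun t _ => ?_
  rw [prod_one_sub_X_pow, Finset.mul_sum, finsetSum_coeff]
  refine Finset.sum_congr rfl fun A _ => ?_
  have h : (X ^ (t + k) * ((-1) ^ A.card * X ^ (∑ i ∈ A, i)) : ℤ[X]) =
      C ((-1) ^ A.card) * X ^ (t + k + ∑ i ∈ A, i) := by
    rw [C_pow, C_neg, C_1]
    ring
  rw [h, coeff_C_mul, coeff_X_pow]
  simp [eq_comm]

section Parts

variable {n : ℕ} (p : n.Partition)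

theorem parts_ne_zero_of_pos (hn : 0 < n) : p.parts ≠ 0 := by
  intro h
  have := p.parts_sum
  simp [h] at this
  omega

theorem smallestPart_mem (hn : 0 < n) : smallestPart p ∈ p.parts :=
  Nat.sInf_mem (s := {j | j ∈ p.parts}) (Multiset.exists_mem_of_ne_zero (parts_ne_zero_of_pos p hn))

variable {p} in
theorem smallestPart_le {i : ℕ} (hi : i ∈ p.parts) : smallestPart p ≤ i :=
  Nat.sInf_le (s := {j | j ∈ p.parts}) hi

variable {p} in
theorem le_largestPart {i : ℕ} (hi : i ∈ p.parts) : i ≤ largestPart p :=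
  Finset.le_sup (f := id) (Multiset.mem_toFinset.2 hi)

theorem largestPart_mem (hn : 0 < n) : largestPart p ∈ p.parts := by
  have hne : p.parts.toFinset.Nonempty := by
    simpa [Finset.nonempty_iff_ne_empty] using parts_ne_zero_of_pos p hn
  obtain ⟨i, hi, h⟩ := Finset.exists_mem_eq_sup p.parts.toFinset hne id
  rw [largestPart, h]
  exact Multiset.mem_toFinset.1 hi

theorem largestPart_le : largestPart p ≤ n :=
  Finset.sup_le fun _ hi => p.le_of_mem_parts (Multiset.mem_toFinset.1 hi)

end Parts

theorem sum_window_eq_coeff {n k : ℕ} (hn : 0 < n) (hk : 0 < k) :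
    ∑ p ∈ D n with largestPart p - smallestPart p < k ∧ k ≤ largestPart p,
      (-1 : ℤ) ^ (numParts p - 1) = (windowPoly k n).coeff n := by
  rw [coeff_windowPoly_eq_sum]
  refine Finset.sum_bij
    (fun p _ => ⟨largestPart p - k, p.parts.toFinset.erase (largestPart p)⟩) ?_ ?_ ?_ ?_
  · intro p hp
    simp only [D, Finset.mem_filter, Finset.mem_univ, true_and] at hp
    obtain ⟨hd, h1, h2⟩ := hp
    have hl := largestPart_le p
    have hmem := Multiset.mem_toFinset.2 (largestPart_mem p hn)
    simp only [Finset.mem_filter, Finset.mem_sigma, Finset.mem_range, Finset.mem_powerset]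
    refine ⟨⟨by omega, fun i hi => ?_⟩, ?_⟩
    · rw [Finset.mem_erase, Multiset.mem_toFinset] at hi
      have := le_largestPart hi.2
      have := smallestPart_le hi.2
      rw [Finset.mem_Ico]
      have := hi.1
      omega
    · rw [Nat.sub_add_cancel h2, Finset.add_sum_erase _ (fun i => i) hmem]
      refine (Finset.sum_val p.parts.toFinset).symm.trans ?_
      rw [Multiset.toFinset_val, Multiset.dedup_eq_self.2 hd, p.parts_sum]
  · intro p hp q hq h
    simp only [D, Finset.mem_filter, Finset.mem_univ, true_and] at hp hq
    simp only [Sigma.mk.injEq, heq_eq_eq] at h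
    have hl : largestPart p = largestPart q := by omega
    have h2 := congrArg (insert (largestPart p)) h.2
    rw [Finset.insert_erase (Multiset.mem_toFinset.2 (largestPart_mem p hn)), hl,
      Finset.insert_erase (Multiset.mem_toFinset.2 (largestPart_mem q hn))] at h2
    refine Nat.Partition.ext ?_
    rw [← Multiset.dedup_eq_self.2 hp.1, ← Multiset.dedup_eq_self.2 hq.1]
    exact congrArg Finset.val h2
  · rintro ⟨t, A⟩ hx
    simp only [Finset.mem_filter, Finset.mem_sigma, Finset.mem_range, Finset.mem_powerset] at hx
    obtain ⟨⟨ht, hA⟩, hsum⟩ := hx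
    have hA' : ∀ i ∈ A, t + 1 ≤ i ∧ i < t + k := fun i hi => Finset.mem_Ico.1 (hA hi)
    have hnot : t + k ∉ A := fun h => (hA' _ h).2.false
    let p : n.Partition :=
      { parts := (insert (t + k) A).val
        parts_pos := by
          intro i hi
          rcases Finset.mem_insert.1 hi with rfl | hi
          · omega
          · have := hA' i hi
            omega
        parts_sum := by
          rw [Finset.sum_val, Finset.sum_insert hnot]
          exact hsum }
    have hmem : ∀ i, i ∈ p.parts ↔ i = t + k ∨ i ∈ A := fun i => Finset.mem_insert
    have hl : largestPart p = t + k := by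
      refine le_antisymm ?_ (le_largestPart ((hmem _).2 (Or.inl rfl)))
      rcases (hmem _).1 (largestPart_mem p hn) with h | h
      · exact h.le
      · exact (hA' _ h).2.le
    have hs : t + 1 ≤ smallestPart p := by
      rcases (hmem _).1 (smallestPart_mem p hn) with h | h
      · omega
      · exact (hA' _ h).1
    have hpA : p.parts.toFinset = insert (t + k) A := by
      ext i
      rw [Multiset.mem_toFinset, hmem, Finset.mem_insert]
    refine ⟨p, ?_, ?_⟩
    · simp only [D, Finset.mem_filter, Finset.mem_univ, true_and]
      exact ⟨(insert (t + k) A).nodup, by omega, by omega⟩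
    · rw [hl, hpA, Finset.erase_insert hnot, Nat.add_sub_cancel]
  · intro p hp
    simp only [D, Finset.mem_filter, Finset.mem_univ, true_and] at hp
    rw [Finset.card_erase_of_mem (Multiset.mem_toFinset.2 (largestPart_mem p hn)),
      Multiset.toFinset_card_of_nodup hp.1, numParts]

theorem sum_Icc_smallestPart_eq {n : ℕ} (hn : 0 < n) (p : n.Partition) (f : ℕ → ℤ) :
    ∑ j ∈ Finset.Icc 1 (smallestPart p), f (largestPart p - smallestPart p + j) =
      ∑ k ∈ Finset.Icc 1 n with
        largestPart p - smallestPart p < k ∧ k ≤ largestPart p, f k := by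
  have hs := le_largestPart (smallestPart_mem p hn)
  have hl := largestPart_le p
  refine Finset.sum_bij (fun j _ => largestPart p - smallestPart p + j) ?_ ?_ ?_ fun _ _ => rfl
  · intro j hj
    simp only [Finset.mem_Icc, Finset.mem_filter] at hj ⊢
    omega
  · intro i _ j _ h
    omega
  · intro k hk
    simp only [Finset.mem_Icc, Finset.mem_filter] at hk
    exact ⟨k - (largestPart p - smallestPart p), Finset.mem_Icc.2 (by omega), by omega⟩

theorem stmt5 (m : ℕ) (n : ℕ) (hn : 0 < n) :
    ∑ p ∈ D n, (-1 : ℤ) ^ (numParts p - 1) *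
      ∑ j ∈ Finset.Icc 1 (smallestPart p),
        ((largestPart p - smallestPart p + j : ℕ) : ℤ) ^ m
    = ∑ d ∈ n.divisors, (d : ℤ) ^ m := by
  have hdiv : n.divisors = {k ∈ Finset.Icc 1 n | k ∣ n} := by
    ext k
    simp only [Nat.mem_divisors, Finset.mem_filter, Finset.mem_Icc]
    exact ⟨fun h => ⟨⟨Nat.pos_of_dvd_of_pos h.1 hn, Nat.le_of_dvd hn h.1⟩, h.1⟩,
      fun h => ⟨h.2, hn.ne'⟩⟩
  simp only [sum_Icc_smallestPart_eq hn _ fun k => (k : ℤ) ^ m, Finset.mul_sum, Finset.sum_filter]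
  rw [Finset.sum_comm, hdiv, Finset.sum_filter]
  refine Finset.sum_congr rfl fun k hk => ?_
  have hk : 0 < k := (Finset.mem_Icc.1 hk).1
  have h := sum_window_eq_coeff hn hk
  rw [coeff_windowPoly hk n (by omega), Finset.sum_filter] at h
  have h' := congrArg (· * (k : ℤ) ^ m) h
  simpa [Finset.sum_mul, hn.ne', ite_mul, mul_ite] using h'
end

section
/- Let q, a, b be complex numbers with |q| < 1, a ≠ 0, and 1 - b q^n ≠ 0 for all n ≥ 1. Then (-aq;q)_∞ / (bq;q)_∞ = ∑_{n=0}^∞ ( (-b/a;q)_n a^n q^{n(n+1)/2} ) / ( (q;q)_n (bq;q)_n ). -/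
/-- The finite q-Pochhammer symbol `(A;q)_n = (1-A)(1-Aq)⋯(1-Aq^{n-1})`. -/
noncomputable def qPoch (q A : ℂ) (n : ℕ) : ℂ := ∏ k ∈ Finset.range n, (1 - A * q ^ k)

/-- The infinite q-Pochhammer symbol `(A;q)_∞ = ∏_{k≥0} (1 - A q^k)`. -/
noncomputable def qPochInf (q A : ℂ) : ℂ := ∏' k : ℕ, (1 - A * q ^ k)

open Filter Topology

lemma qPoch_succ (q A : ℂ) (n : ℕ) : qPoch q A (n + 1) = qPoch q A n * (1 - A * q ^ n) :=
  Finset.prod_range_succ _ _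

lemma summable_norm_neg_mul_pow {q : ℂ} (hq : ‖q‖ < 1) (A : ℂ) :
    Summable fun k : ℕ => ‖-(A * q ^ k)‖ := by
  simpa [norm_mul, norm_pow] using
    (summable_geometric_of_lt_one (norm_nonneg q) hq).mul_left ‖A‖

lemma tendsto_qPoch {q : ℂ} (hq : ‖q‖ < 1) (A : ℂ) :
    Tendsto (qPoch q A) atTop (𝓝 (qPochInf q A)) := by
  have h := (multipliable_one_add_of_summable
    (summable_norm_neg_mul_pow hq A)).hasProd.tendsto_prod_nat
  simp only [← sub_eq_add_neg] at h
  exact h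

lemma qPochInf_ne_zero {q A : ℂ} (hq : ‖q‖ < 1) (hA : ∀ k : ℕ, 1 - A * q ^ k ≠ 0) :
    qPochInf q A ≠ 0 := by
  have h := tprod_one_add_ne_zero_of_summable (f := fun k : ℕ => -(A * q ^ k))
    (fun k => by simpa only [← sub_eq_add_neg] using hA k) (summable_norm_neg_mul_pow hq A)
  simp only [← sub_eq_add_neg] at h
  exact h

lemma exists_norm_inv_qPoch_le {q A : ℂ} (hq : ‖q‖ < 1) (hA : ∀ k : ℕ, 1 - A * q ^ k ≠ 0) :
    ∃ C : ℝ, ∀ n, ‖(qPoch q A n)⁻¹‖ ≤ C := by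
  obtain ⟨C, hC⟩ := ((tendsto_qPoch hq A).inv₀ (qPochInf_ne_zero hq hA)).norm.bddAbove_range
  exact ⟨C, fun n => hC ⟨n, rfl⟩⟩

lemma succ_mul_succ_succ_div_two (n : ℕ) :
    (n + 1) * (n + 1 + 1) / 2 = n * (n + 1) / 2 + (n + 1) := by
  rw [show (n + 1) * (n + 1 + 1) = n * (n + 1) + (n + 1) * 2 by ring,
    Nat.add_mul_div_right _ _ two_pos]

lemma summable_pow_mul_pow_triangle (M : ℝ) {r : ℝ} (hr0 : 0 ≤ r) (hr : r < 1) :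
    Summable fun n : ℕ => M ^ n * r ^ (n * (n + 1) / 2) := by
  have h : Tendsto (fun n : ℕ => ‖M * r ^ (n + 1)‖) atTop (𝓝 0) := by
    simpa using (((tendsto_pow_atTop_nhds_zero_of_lt_one hr0 hr).comp
      (tendsto_add_atTop_nat 1)).const_mul M).norm
  refine summable_of_ratio_norm_eventually_le (r := 1 / 2) (by norm_num) ?_
  filter_upwards [h.eventually_le_const (show (0 : ℝ) < 1 / 2 by norm_num)] with n hn
  rw [succ_mul_succ_succ_div_two, pow_succ, pow_add,
    show M ^ n * M * (r ^ (n * (n + 1) / 2) * r ^ (n + 1))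
      = (M * r ^ (n + 1)) * (M ^ n * r ^ (n * (n + 1) / 2)) by ring, norm_mul]
  gcongr

/-- Up to the factor `(bq;q)_N`, the `n`-th term of the series of `stmt10` at the parameters
`a q ^ N` and `b q ^ N`. -/
noncomputable def shiftedTerm (q a b : ℂ) (N n : ℕ) : ℂ :=
  q ^ (N * n) * (∏ k ∈ Finset.range n, (a + b * q ^ k)) * q ^ (n * (n + 1) / 2) *
    (qPoch q q n)⁻¹ * (qPoch q (b * q) (n + N))⁻¹

lemma one_sub_self_mul_pow_ne_zero {q : ℂ} (hq : ‖q‖ < 1) (k : ℕ) : 1 - q * q ^ k ≠ 0 := by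
  rw [← pow_succ']
  intro h
  have h1 : ‖q ^ (k + 1)‖ < 1 := by
    rw [norm_pow]
    exact pow_lt_one₀ (norm_nonneg q) hq k.succ_ne_zero
  rw [← sub_eq_zero.mp h, norm_one] at h1
  exact lt_irrefl _ h1

lemma exists_summable_norm_shiftedTerm_le {q : ℂ} (hq : ‖q‖ < 1) (a : ℂ) {b : ℂ}
    (hb : ∀ k : ℕ, 1 - b * q * q ^ k ≠ 0) :
    ∃ B : ℕ → ℝ, Summable B ∧ ∀ N n, ‖shiftedTerm q a b N n‖ ≤ B n := by
  obtain ⟨C, hC⟩ := exists_norm_inv_qPoch_le hq (one_sub_self_mul_pow_ne_zero hq)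
  obtain ⟨D, hD⟩ := exists_norm_inv_qPoch_le hq hb
  have hC0 : 0 ≤ C := (norm_nonneg _).trans (hC 0)
  refine ⟨_, ((summable_pow_mul_pow_triangle (‖a‖ + ‖b‖) (norm_nonneg q) hq).mul_right
    C).mul_right D, fun N n => ?_⟩
  have hP : ‖∏ k ∈ Finset.range n, (a + b * q ^ k)‖ ≤ (‖a‖ + ‖b‖) ^ n := by
    rw [norm_prod]
    refine (Finset.prod_le_prod (fun _ _ => norm_nonneg _)
      (g := fun _ => ‖a‖ + ‖b‖) fun k _ => ?_).trans_eq (by simp)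
    refine (norm_add_le _ _).trans (add_le_add_right ?_ _)
    rw [norm_mul, norm_pow]
    exact mul_le_of_le_one_right (norm_nonneg b) (pow_le_one₀ (norm_nonneg q) hq.le)
  have hQ : ‖q ^ (N * n)‖ ≤ 1 := by
    rw [norm_pow]
    exact pow_le_one₀ (norm_nonneg q) hq.le
  rw [shiftedTerm, norm_mul, norm_mul, norm_mul, norm_mul, norm_pow q (n * (n + 1) / 2)]
  gcongr
  · exact (mul_le_mul hQ hP (norm_nonneg _) zero_le_one).trans_eq (one_mul _)
  · exact hC n
  · exact hD _

lemma shiftedTerm_sub {q : ℂ} (hq : ‖q‖ < 1) (a : ℂ) {b : ℂ}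
    (hb : ∀ k : ℕ, 1 - b * q * q ^ k ≠ 0) (N n : ℕ) :
    shiftedTerm q a b N n - (1 + a * q ^ (N + 1)) * shiftedTerm q a b (N + 1) n
      = shiftedTerm q a b N n * (1 - q ^ n)
        - shiftedTerm q a b N (n + 1) * (1 - q ^ (n + 1)) := by
  simp only [shiftedTerm, succ_mul_succ_succ_div_two, Finset.prod_range_succ, qPoch_succ,
    show n + (N + 1) = n + N + 1 by ring, show n + 1 + N = n + N + 1 by ring, mul_inv]
  have e1 : (1 - q * q ^ n)⁻¹ * (1 - q ^ (n + 1)) = 1 := by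
    rw [pow_succ', inv_mul_cancel₀ (one_sub_self_mul_pow_ne_zero hq n)]
  have e2 : (1 - b * q * q ^ (n + N)) * (1 - b * q * q ^ (n + N))⁻¹ = 1 :=
    mul_inv_cancel₀ (hb (n + N))
  generalize (1 - b * q * q ^ (n + N))⁻¹ = v at *
  generalize (1 - q * q ^ n)⁻¹ = u at *
  generalize (qPoch q q n)⁻¹ = x
  generalize (qPoch q (b * q) (n + N))⁻¹ = y
  generalize ∏ k ∈ Finset.range n, (a + b * q ^ k) = P
  generalize n * (n + 1) / 2 = t
  linear_combination
    (q ^ (N * n) * P * q ^ t * x * y) * (-q ^ n) * e2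
      + (q ^ (N * (n + 1)) * P * (a + b * q ^ n) * q ^ (t + (n + 1)) * x * y * v) * e1

lemma tsum_shiftedTerm_succ {q : ℂ} (hq : ‖q‖ < 1) (a : ℂ) {b : ℂ}
    (hb : ∀ k : ℕ, 1 - b * q * q ^ k ≠ 0) (N : ℕ) :
    ∑' n, shiftedTerm q a b N n
      = (1 + a * q ^ (N + 1)) * ∑' n, shiftedTerm q a b (N + 1) n := by
  obtain ⟨B, hB, hle⟩ := exists_summable_norm_shiftedTerm_le hq a hb
  have hs (N : ℕ) : Summable (shiftedTerm q a b N) := .of_norm_bounded hB (hle N)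
  have hG : Summable fun n => shiftedTerm q a b N n * (1 - q ^ n) := by
    refine .of_norm_bounded (hB.mul_right 2) fun n => ?_
    rw [norm_mul]
    refine mul_le_mul (hle N n) ((norm_sub_le _ _).trans ?_) (norm_nonneg _)
      ((norm_nonneg _).trans (hle N n))
    rw [norm_one, norm_pow]
    linarith [pow_le_one₀ (n := n) (norm_nonneg q) hq.le]
  rw [← tsum_mul_left, ← sub_eq_zero, ← (hs N).tsum_sub ((hs (N + 1)).mul_left _)]
  simp_rw [shiftedTerm_sub hq a hb N]
  rw [hG.tsum_sub ((summable_nat_add_iff 1).mpr hG), hG.tsum_eq_zero_add]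
  simp

lemma tsum_shiftedTerm_zero {q : ℂ} (hq : ‖q‖ < 1) (a : ℂ) {b : ℂ}
    (hb : ∀ k : ℕ, 1 - b * q * q ^ k ≠ 0) (N : ℕ) :
    ∑' n, shiftedTerm q a b 0 n = qPoch q (-(a * q)) N * ∑' n, shiftedTerm q a b N n := by
  induction N with
  | zero => simp [qPoch]
  | succ N ih =>
    rw [ih, tsum_shiftedTerm_succ hq a hb N, qPoch_succ]
    ring

lemma tendsto_tsum_shiftedTerm {q : ℂ} (hq : ‖q‖ < 1) (a : ℂ) {b : ℂ}
    (hb : ∀ k : ℕ, 1 - b * q * q ^ k ≠ 0) :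
    Tendsto (fun N => ∑' n, shiftedTerm q a b N n) atTop (𝓝 (qPochInf q (b * q))⁻¹) := by
  obtain ⟨B, hB, hle⟩ := exists_summable_norm_shiftedTerm_le hq a hb
  have hinv := (tendsto_qPoch hq (b * q)).inv₀ (qPochInf_ne_zero hq hb)
  rw [← tsum_ite_eq (0 : ℕ) fun _ => (qPochInf q (b * q))⁻¹]
  refine tendsto_tsum_of_dominated_convergence hB (fun n => ?_) (.of_forall hle)
  rcases Nat.eq_zero_or_pos n with rfl | hn
  · simpa [shiftedTerm, qPoch] using hinv
  · have hpow : Tendsto (fun N : ℕ => q ^ (N * n)) atTop (𝓝 0) := by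
      refine (tendsto_pow_atTop_nhds_zero_of_norm_lt_one hq).comp ?_
      exact tendsto_id.atTop_mul_const' hn
    have hshift := hinv.comp (tendsto_atTop_mono (fun N => Nat.le_add_left N n) tendsto_id)
    have h := (((hpow.mul_const (∏ k ∈ Finset.range n, (a + b * q ^ k))).mul_const
      (q ^ (n * (n + 1) / 2))).mul_const (qPoch q q n)⁻¹).mul hshift
    simpa [shiftedTerm, hn.ne'] using h

lemma qPoch_neg_div_mul_pow (q b : ℂ) {a : ℂ} (ha : a ≠ 0) (n : ℕ) :
    qPoch q (-(b / a)) n * a ^ n = ∏ k ∈ Finset.range n, (a + b * q ^ k) := by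
  rw [qPoch, ← Finset.card_range n, ← Finset.prod_const, Finset.card_range,
    ← Finset.prod_mul_distrib]
  refine Finset.prod_congr rfl fun k _ => ?_
  field_simp
  ring

theorem stmt10 (q a b : ℂ) (hq : ‖q‖ < 1) (ha : a ≠ 0)
    (hb : ∀ n : ℕ, 1 - b * q ^ (n + 1) ≠ 0) :
    qPochInf q (-(a * q)) / qPochInf q (b * q)
      = ∑' n : ℕ, (qPoch q (-(b / a)) n * a ^ n * q ^ (n * (n + 1) / 2)) /
          (qPoch q q n * qPoch q (b * q) n) := by
  have hb' (k : ℕ) : 1 - b * q * q ^ k ≠ 0 := by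
    rw [mul_assoc, ← pow_succ']
    exact hb k
  have hlim := (tendsto_qPoch hq (-(a * q))).mul (tendsto_tsum_shiftedTerm hq a hb')
  simp_rw [← tsum_shiftedTerm_zero hq a hb'] at hlim
  rw [div_eq_mul_inv, tendsto_nhds_unique hlim tendsto_const_nhds]
  refine tsum_congr fun n => ?_
  rw [qPoch_neg_div_mul_pow q b ha, shiftedTerm, div_eq_mul_inv, mul_inv]
  simp [mul_assoc]
end
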